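/- arXiv:2104.09451 — 3 statements merged into one kernel-verified Lean document; each statement's English description precedes it below -/
import Mathlib

section
/- For every finite connected simple graph G, the minimum of f_d(G,v) over all vertices v equals the minimum cardinality of a closed set of vertices of G. -/
open SimpleGraph

variable {V : Type*}

/-- The eccentricity of a vertex: the maximum graph distance to any vertex. -/
noncomputable def ecc [Fintype V] (G : SimpleGraph V) (u : V) : ℕ :=
  Finset.univ.sup fun w => G.dist u w

/-- The diameter of a graph: the maximum eccentricity. -/
noncomputable def graphDiam [Fintype V] (G : SimpleGraph V) : ℕ :=
  Finset.univ.sup fun u => ecc G u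

/-- A nonempty set `U` of vertices is closed if for every `u ∈ U` and every vertex `v`
there is `x ∈ U` with `dist u v = dist u x`. -/
def IsClosedSet (G : SimpleGraph V) (U : Set V) : Prop :=
  U.Nonempty ∧ ∀ u ∈ U, ∀ v : V, ∃ x ∈ U, G.dist u v = G.dist u x

/-- An Explorer strategy (assigning a called distance to each history, most recent
vertex first) is valid if, whenever the current vertex `u` has a legal call available
(`1 ≤ ecc u`), it calls some `k` with `1 ≤ k ≤ ecc u`. -/
def EValid [Fintype V] (G : SimpleGraph V) (ES : List V → ℕ) : Prop :=
  ∀ h : List V, ∀ u : V, h.head? = some u → 1 ≤ ecc G u →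
    1 ≤ ES h ∧ ES h ≤ ecc G u

/-- A Director strategy is valid if, for each history with current vertex `u` and each
legal called distance `k` (`1 ≤ k ≤ ecc u`), it answers a vertex at distance exactly `k`. -/
def DValid [Fintype V] (G : SimpleGraph V) (DS : List V → ℕ → V) : Prop :=
  ∀ h : List V, ∀ u : V, h.head? = some u → ∀ k : ℕ, 1 ≤ k → k ≤ ecc G u →
    G.dist u (DS h k) = k

/-- The history (most recent vertex first) of the first `n` moves of the play determined
by Explorer strategy `ES` and Director strategy `DS`, starting at `v`. -/
def play (ES : List V → ℕ) (DS : List V → ℕ → V) (v : V) : ℕ → List V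
  | 0 => [v]
  | n + 1 => DS (play ES DS v n) (ES (play ES DS v n)) :: play ES DS v n

/-- The number of distinct vertices visited in the play determined by `ES` and `DS`
starting at `v`. -/
noncomputable def playScore (ES : List V → ℕ) (DS : List V → ℕ → V) (v : V) : ℕ :=
  Set.ncard {x : V | ∃ n : ℕ, x ∈ play ES DS v n}

/-- `fd G v` : the max over valid Explorer strategies of the min over valid Director
strategies of the number of distinct vertices visited. -/
noncomputable def fd [Fintype V] (G : SimpleGraph V) (v : V) : ℕ :=
  sSup {r : ℕ | ∃ ES : List V → ℕ, EValid G ES ∧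
    r = sInf {s : ℕ | ∃ DS : List V → ℕ → V, DValid G DS ∧ s = playScore ES DS v}}

/-- A play `x` is consistent with the nonadaptive strategy `S` from start `v` if it starts
at `v` and each step has the prescribed length. -/
def NAConsistent (G : SimpleGraph V) (S : List ℕ) (v : V) (x : ℕ → V) : Prop :=
  x 0 = v ∧ ∀ i < S.length, G.dist (x i) (x (i + 1)) = S.getD i 0

/-- A nonadaptive strategy is playable from `v` if every consistent initial segment
can be extended. -/
def NAPlayable (G : SimpleGraph V) (S : List ℕ) (v : V) : Prop :=
  ∀ x : ℕ → V, ∀ i < S.length, x 0 = v →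
    (∀ j < i, G.dist (x j) (x (j + 1)) = S.getD j 0) →
    ∃ y : V, G.dist (x i) y = S.getD i 0

/-- The score of a nonadaptive strategy `S` from `v`: the minimum over consistent plays
of the number of distinct vertices among `x 0, …, x S.length`. -/
noncomputable def naScore (G : SimpleGraph V) (S : List ℕ) (v : V) : ℕ :=
  sInf {k : ℕ | ∃ x : ℕ → V, NAConsistent G S v x ∧
    k = Set.ncard {w : V | ∃ i ≤ S.length, x i = w}}

/-- The `n × m` grid graph: the box product of two path graphs. -/
def gridGraph (n m : ℕ) : SimpleGraph (Fin n × Fin m) :=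
  (pathGraph n) □ (pathGraph m)

theorem exists_dist_eq_of_le_ecc [Fintype V] {G : SimpleGraph V} (hG : G.Connected) {u : V}
    {k : ℕ} (hk : k ≤ ecc G u) : ∃ w, G.dist u w = k := by
  obtain ⟨z, -, hz⟩ := Finset.exists_mem_eq_sup Finset.univ ⟨u, Finset.mem_univ u⟩
    (fun w => G.dist u w)
  obtain ⟨p, hp⟩ := hG.exists_walk_length_eq_dist u z
  have hkz : k ≤ p.length := by rw [hp, ← hz]; exact hk
  refine ⟨p.getVert k, le_antisymm ?_ ?_⟩
  · exact (dist_le (p.take k)).trans (by simp)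
  · have h1 := hG.dist_triangle (u := u) (v := p.getVert k) (w := z)
    have h2 := dist_le (p.drop k)
    rw [Walk.drop_length] at h2
    omega

theorem isClosedSet_univ [Nonempty V] (G : SimpleGraph V) : IsClosedSet G Set.univ :=
  ⟨Set.univ_nonempty, fun _ _ v => ⟨v, Set.mem_univ v, rfl⟩⟩

theorem play_ne_nil (ES : List V → ℕ) (DS : List V → ℕ → V) (v : V) (n : ℕ) :
    play ES DS v n ≠ [] := by
  cases n <;> simp [play]

/-- The Director can keep the token inside a closed set. -/
theorem IsClosedSet.exists_dValid [Fintype V] {G : SimpleGraph V} (hG : G.Connected)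
    {U : Set V} (hU : IsClosedSet G U) {v : V} (hv : v ∈ U) :
    ∃ DS : List V → ℕ → V, DValid G DS ∧
      ∀ ES : List V → ℕ, playScore ES DS v ≤ U.ncard := by
  have key : ∀ (h : List V) (k : ℕ), ∃ w : V, ∀ u, h.head? = some u →
      ((∃ y, G.dist u y = k) → G.dist u w = k) ∧ (u ∈ U → w ∈ U) := by
    rintro (_ | ⟨u, t⟩) k
    · exact ⟨v, by simp⟩
    · simp only [List.head?_cons, Option.some.injEq, forall_eq']
      by_cases hy : ∃ y, G.dist u y = k
      · obtain ⟨y, hy⟩ := hy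
        by_cases hu : u ∈ U
        · obtain ⟨x, hx, hxy⟩ := hU.2 u hu y
          exact ⟨x, fun _ => hxy ▸ hy, fun _ => hx⟩
        · exact ⟨y, fun _ => hy, fun h => absurd h hu⟩
      · exact ⟨v, fun h => absurd h hy, fun _ => hv⟩
  choose DS hDS using key
  refine ⟨DS, fun h u hu k _ hk => (hDS h k u hu).1 (exists_dist_eq_of_le_ecc hG hk),
    fun ES => ?_⟩
  have hmem : ∀ n, ∀ x ∈ play ES DS v n, x ∈ U := by
    intro n
    induction n with
    | zero => simpa [play] using hv
    | succ n ih =>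
      intro x hx
      rcases List.mem_cons.1 hx with rfl | hx
      · have hhead := List.head?_eq_some_head (play_ne_nil ES DS v n)
        exact (hDS _ _ _ hhead).2 (ih _ (List.head_mem _))
      · exact ih x hx
  refine Set.ncard_le_ncard ?_ U.toFinite
  rintro x ⟨n, hn⟩
  exact hmem n x hn

theorem exists_frequently_and_eq [Finite V] {x : ℕ → V} {P : V → Prop}
    (h : ∃ᶠ n in Filter.atTop, P (x n)) : ∃ w, P w ∧ ∃ᶠ n in Filter.atTop, x n = w := by
  by_contra! hc
  refine h ?_
  have hall : ∀ w, ∀ᶠ n in Filter.atTop, P w → x n ≠ w := by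
    intro w
    by_cases hw : P w
    · exact (hc w hw).mono fun n hn _ => hn
    · exact Filter.Eventually.of_forall fun n h => absurd h hw
  exact (Filter.eventually_all.2 hall).mono fun n hn hP => hn (x n) hP rfl

open scoped Classical in
/-- The Explorer strategy that, at each vertex, cycles through all legal distances. -/
noncomputable def cyclingExplorer [Fintype V] (G : SimpleGraph V) : List V → ℕ
  | [] => 0
  | u :: t => t.count u % ecc G u + 1

theorem cyclingExplorer_eValid [Fintype V] (G : SimpleGraph V) :
    EValid G (cyclingExplorer G) := by
  rintro (_ | ⟨w, t⟩) u hu hpos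
  · simp at hu
  · obtain rfl : w = u := by simpa using hu
    exact ⟨Nat.le_add_left _ _, Nat.mod_lt _ hpos⟩

/-- Against the cycling Explorer, the vertices visited infinitely often form a closed set. -/
theorem exists_isClosedSet_ncard_le_playScore [Fintype V] (G : SimpleGraph V)
    {DS : List V → ℕ → V} (hDS : DValid G DS) (v : V) :
    ∃ U : Set V, IsClosedSet G U ∧ U.ncard ≤ playScore (cyclingExplorer G) DS v := by
  classical
  set ES := cyclingExplorer G
  set x : ℕ → V := fun n => (play ES DS v n).head (play_ne_nil ES DS v n) with hx
  have hplay : ∀ n, ∃ t, play ES DS v n = x n :: t ∧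
      ∀ u, t.count u = Nat.count (fun i => x i = u) n := by
    intro n
    induction n with
    | zero => exact ⟨[], by simp [hx, play], by simp⟩
    | succ n ih =>
      obtain ⟨t, ht, hcount⟩ := ih
      refine ⟨x n :: t, ?_, fun u => ?_⟩
      · rw [← ht]; simp [hx, play]
      · simp [List.count_cons, Nat.count_succ, hcount]
  refine ⟨{w | ∃ᶠ n in Filter.atTop, x n = w}, ⟨?_, fun u hu w => ?_⟩,
    Set.ncard_le_ncard ?_ (Set.toFinite _)⟩
  · obtain ⟨w, -, hw⟩ := exists_frequently_and_eq (x := x) (P := fun _ => True)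
      (Filter.Frequently.of_forall fun _ => trivial)
    exact ⟨w, hw⟩
  · have hle : G.dist u w ≤ ecc G u := Finset.le_sup (f := G.dist u) (Finset.mem_univ w)
    rcases Nat.eq_zero_or_pos (G.dist u w) with h0 | hpos
    · exact ⟨u, hu, by simpa using h0⟩
    have hinf : {i | x i = u}.Infinite := Nat.frequently_atTop_iff_infinite.1 hu
    have hfreq : ∃ᶠ n in Filter.atTop, G.dist u (x n) = G.dist u w := by
      rw [Filter.frequently_atTop]
      intro N
      set j := ecc G u * N + (G.dist u w - 1) with hj
      set n := Nat.nth (fun i => x i = u) j with hn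
      have hxn : x n = u := Nat.nth_mem_of_infinite hinf j
      have hNj : N ≤ j := (Nat.le_mul_of_pos_left N (hpos.trans_le hle)).trans
        (Nat.le_add_right _ _)
      have hjn : j ≤ n := (Nat.nth_strictMono hinf).le_apply
      refine ⟨n + 1, by omega, ?_⟩
      obtain ⟨t, ht, hcount⟩ := hplay n
      have hcall : ES (play ES DS v n) = G.dist u w := by
        rw [ht, hxn]
        change t.count u % ecc G u + 1 = _
        rw [hcount, hn, Nat.count_nth_of_infinite hinf, hj, Nat.mul_add_mod,
          Nat.mod_eq_of_lt (by omega)]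
        omega
      have hnext : x (n + 1) = DS (play ES DS v n) (G.dist u w) := by
        rw [← hcall]; rfl
      rw [hnext]
      exact hDS _ u (by rw [ht, hxn]; rfl) _ hpos hle
    obtain ⟨z, hz, hzU⟩ := exists_frequently_and_eq (P := fun z => G.dist u z = G.dist u w) hfreq
    exact ⟨z, hzU, hz.symm⟩
  · intro w hw
    obtain ⟨n, rfl⟩ := Filter.Frequently.exists hw
    exact ⟨n, List.head_mem _⟩

theorem fd_le_ncard [Fintype V] {G : SimpleGraph V} (hG : G.Connected)
    {U : Set V} (hU : IsClosedSet G U) {v : V} (hv : v ∈ U) : fd G v ≤ U.ncard := by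
  obtain ⟨DS, hDS, hscore⟩ := hU.exists_dValid hG hv
  refine csSup_le (Set.nonempty_of_mem ⟨_, cyclingExplorer_eValid G, rfl⟩) ?_
  rintro r ⟨ES, -, rfl⟩
  exact le_trans (Nat.sInf_le ⟨DS, hDS, rfl⟩) (hscore ES)

theorem exists_isClosedSet_ncard_le_fd [Fintype V] {G : SimpleGraph V} (hG : G.Connected)
    (v : V) : ∃ U : Set V, IsClosedSet G U ∧ U.ncard ≤ fd G v := by
  have : Nonempty V := ⟨v⟩
  obtain ⟨DS, hDS, hscore⟩ := (isClosedSet_univ G).exists_dValid hG (Set.mem_univ v)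
  obtain ⟨DS', hDS', heq⟩ := Nat.sInf_mem
    (s := {s | ∃ DS, DValid G DS ∧ s = playScore (cyclingExplorer G) DS v})
    (Set.nonempty_of_mem ⟨DS, hDS, rfl⟩)
  obtain ⟨U, hU, hle⟩ := exists_isClosedSet_ncard_le_playScore G hDS' v
  refine ⟨U, hU, (heq ▸ hle).trans (le_csSup ⟨(Set.univ : Set V).ncard, ?_⟩
    ⟨_, cyclingExplorer_eValid G, rfl⟩)⟩
  rintro r ⟨ES, -, rfl⟩
  exact le_trans (Nat.sInf_le ⟨DS, hDS, rfl⟩) (hscore ES)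

/-- For every finite connected simple graph `G`, the minimum of `f_d(G,v)`
over all vertices `v` equals the minimum cardinality of a closed set of vertices of `G`. -/
theorem stmt_0 {V : Type*} [Fintype V] (G : SimpleGraph V) (hG : G.Connected) :
    sInf {r : ℕ | ∃ v : V, r = fd G v} =
      sInf {r : ℕ | ∃ U : Set V, IsClosedSet G U ∧ r = U.ncard} := by
  have := hG.nonempty
  apply le_antisymm
  · refine le_csInf (Set.nonempty_of_mem ⟨Set.univ, isClosedSet_univ G, rfl⟩) ?_
    rintro r ⟨U, hU, rfl⟩
    obtain ⟨v, hv⟩ := hU.1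
    exact le_trans (Nat.sInf_le ⟨v, rfl⟩) (fd_le_ncard hG hU hv)
  · refine le_csInf (Set.nonempty_of_mem ⟨Classical.arbitrary V, rfl⟩) ?_
    rintro r ⟨v, rfl⟩
    obtain ⟨U, hU, hle⟩ := exists_isClosedSet_ncard_le_fd hG v
    exact le_trans (Nat.sInf_le ⟨U, hU, rfl⟩) hle
end

section
/- For every integer b ≥ 2 and every integer k with 2 ≤ k ≤ b, there exists a connected simple graph G on b vertices such that the minimum of f_d(G,v) over all vertices v equals k. -/
open SimpleGraph

variable {V : Type*}

section Distance

variable {G : SimpleGraph V} {D : V → V → ℕ}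

/-- If `D · v` vanishes only at `v` and, where positive, drops by exactly one along some edge,
then there are walks of length `D u v`. -/
theorem exists_walk_length_eq (h_zero : ∀ u v, D u v = 0 → u = v)
    (h_step : ∀ u v n, D u v = n + 1 → ∃ w, G.Adj u w ∧ D w v = n) (u v : V) :
    ∃ q : G.Walk u v, q.length = D u v := by
  induction hn : D u v generalizing u with
  | zero =>
    obtain rfl := h_zero u v hn
    exact ⟨Walk.nil, rfl⟩
  | succ n ih =>
    obtain ⟨w, h_adj, hw⟩ := h_step u v n hn
    obtain ⟨q, hq⟩ := ih w hw
    exact ⟨Walk.cons h_adj q, by simp [hq]⟩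

/-- If `D · v` vanishes at `v` and drops by at most one along each edge, then it bounds the
lengths of walks to `v` from below. -/
theorem le_walk_length (h_self : ∀ v, D v v = 0)
    (h_adj : ∀ u w v, G.Adj u w → D u v ≤ D w v + 1) {u v : V} (q : G.Walk u v) :
    D u v ≤ q.length := by
  induction q with
  | nil => simp [h_self]
  | cons h q ih =>
    rw [Walk.length_cons]
    exact (h_adj _ _ _ h).trans (by omega)

end Distance

section Game

theorem mem_play_of_le {ES : List V → ℕ} {DS : List V → ℕ → V} {v x : V} {i j : ℕ} (hij : i ≤ j)
    (hx : x ∈ play ES DS v i) : x ∈ play ES DS v j := by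
  induction hij with
  | refl => exact hx
  | step _ ih => exact List.mem_cons_of_mem _ ih

theorem exists_head?_play (ES : List V → ℕ) (DS : List V → ℕ → V) (v : V) (n : ℕ) :
    ∃ u, (play ES DS v n).head? = some u := by
  cases n <;> exact ⟨_, rfl⟩

variable [Fintype V] {G : SimpleGraph V} {v : V} {m : ℕ}

theorem fd_le {DS : List V → ℕ → V} (hDS : DValid G DS)
    (h : ∀ ES, EValid G ES → playScore ES DS v ≤ m) : fd G v ≤ m := by
  refine csSup_le' ?_
  rintro _ ⟨ES, hES, rfl⟩
  exact le_trans (Nat.sInf_le ⟨DS, hDS, rfl⟩) (h ES hES)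

theorem le_fd {DS : List V → ℕ → V} (hDS : DValid G DS) {ES : List V → ℕ} (hES : EValid G ES)
    (h : ∀ DS', DValid G DS' → m ≤ playScore ES DS' v) : m ≤ fd G v := by
  have h_le : m ≤ sInf {s : ℕ | ∃ DS : List V → ℕ → V, DValid G DS ∧ s = playScore ES DS v} := by
    refine le_csInf ⟨_, DS, hDS, rfl⟩ ?_
    rintro _ ⟨DS', hDS', rfl⟩
    exact h DS' hDS'
  refine h_le.trans (le_csSup ⟨Fintype.card V, ?_⟩ ⟨ES, hES, rfl⟩)
  rintro _ ⟨ES', -, rfl⟩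
  refine le_trans (Nat.sInf_le ⟨DS, hDS, rfl⟩) ?_
  rw [← Nat.card_eq_fintype_card]
  exact Set.ncard_le_card _

end Game

/-- The lollipop graph on `b` vertices: a path `0, …, k - 1` whose last vertex is blown up to
the clique of all vertices `i ≥ k - 1`. -/
def lollipopGraph (b k : ℕ) : SimpleGraph (Fin b) where
  Adj i j := i ≠ j ∧ min i.val (k - 1) ≤ min j.val (k - 1) + 1 ∧
    min j.val (k - 1) ≤ min i.val (k - 1) + 1
  symm := ⟨fun _ _ h => ⟨h.1.symm, h.2.2, h.2.1⟩⟩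
  loopless := ⟨fun _ h => h.1 rfl⟩

/-- The closed form of the distance in the lollipop graph. -/
def lollipopDist (b k : ℕ) (i j : Fin b) : ℕ :=
  if i.val = j.val then 0 else
    max 1 (max (min i.val (k - 1) - min j.val (k - 1)) (min j.val (k - 1) - min i.val (k - 1)))

section Lollipop

variable {b k : ℕ}

theorem exists_walk_lollipopGraph (u v : Fin b) :
    ∃ q : (lollipopGraph b k).Walk u v, q.length = lollipopDist b k u v := by
  refine exists_walk_length_eq (D := lollipopDist b k) ?_ ?_ u v
  · intro u v h
    ext
    unfold lollipopDist at h
    split_ifs at h <;> omega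
  · intro u v n h
    have hu := u.isLt
    have hv := v.isLt
    unfold lollipopDist at h
    split_ifs at h with h_eq
    by_cases hn : n = 0
    · refine ⟨v, ⟨fun h' => h_eq (congrArg Fin.val h'), by omega, by omega⟩, ?_⟩
      simp [lollipopDist, hn]
    by_cases huv : u.val < v.val
    · refine ⟨⟨u.val + 1, by omega⟩, ⟨fun h' => ?_, ?_⟩, ?_⟩
      · have := congrArg Fin.val h'
        simp at this
      · simp only
        omega
      · simp only [lollipopDist]
        split_ifs <;> omega
    · refine ⟨⟨min u.val (k - 1) - 1, by omega⟩, ⟨fun h' => ?_, ?_⟩, ?_⟩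
      · have := congrArg Fin.val h'
        simp only at this
        omega
      · simp only
        omega
      · simp only [lollipopDist]
        split_ifs <;> omega

theorem dist_lollipopGraph (u v : Fin b) :
    (lollipopGraph b k).dist u v = lollipopDist b k u v := by
  obtain ⟨q, hq⟩ := exists_walk_lollipopGraph (k := k) u v
  refine le_antisymm (hq ▸ dist_le q) ?_
  obtain ⟨q', hq'⟩ := q.reachable.exists_walk_length_eq_dist
  rw [← hq']
  refine le_walk_length (by simp [lollipopDist]) ?_ q'
  intro u w v h
  have h_ne : u.val ≠ w.val := fun h' => h.1 (Fin.ext h')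
  obtain ⟨-, h₁, h₂⟩ := h
  unfold lollipopDist
  split_ifs <;> omega

theorem connected_lollipopGraph (hb : 0 < b) : (lollipopGraph b k).Connected :=
  have : Nonempty (Fin b) := ⟨⟨0, hb⟩⟩
  ⟨fun u v => (exists_walk_lollipopGraph u v).choose.reachable⟩

theorem ecc_lollipopGraph (hk : 2 ≤ k) (hkb : k ≤ b) (u : Fin b) :
    ecc (lollipopGraph b k) u = max (min u.val (k - 1)) (k - 1 - min u.val (k - 1)) := by
  refine le_antisymm (Finset.sup_le fun w _ => ?_) ?_
  · rw [dist_lollipopGraph, lollipopDist]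
    split_ifs <;> omega
  · have h_le (w : Fin b) : lollipopDist b k u w ≤ ecc (lollipopGraph b k) u := by
      rw [← dist_lollipopGraph]
      exact Finset.le_sup (f := fun w => (lollipopGraph b k).dist u w) (Finset.mem_univ w)
    have h₁ := h_le ⟨0, by omega⟩
    have h₂ := h_le ⟨k - 1, by omega⟩
    simp only [lollipopDist] at h₁ h₂
    split_ifs at h₁ h₂ <;> omega

/-- The Director can always answer with one of the vertices `0, …, k - 1`. -/
theorem exists_dValid_lollipopGraph (hk : 2 ≤ k) (hkb : k ≤ b) :
    ∃ DS : List (Fin b) → ℕ → Fin b, DValid (lollipopGraph b k) DS ∧ ∀ h d, (DS h d).val < k := by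
  have h_move (h : List (Fin b)) (d : ℕ) : ∃ w : Fin b, w.val < k ∧ ∀ u, h.head? = some u →
      1 ≤ d → d ≤ ecc (lollipopGraph b k) u → (lollipopGraph b k).dist u w = d := by
    cases h with
    | nil => exact ⟨⟨0, by omega⟩, by simp only; omega, by simp⟩
    | cons a t =>
      refine ⟨⟨if d ≤ min a.val (k - 1) then min a.val (k - 1) - d
        else min (min a.val (k - 1) + d) (k - 1), by split_ifs <;> omega⟩,
        by simp only; split_ifs <;> omega, ?_⟩
      intro u hu hd hde
      obtain rfl : a = u := by simpa using hu
      rw [ecc_lollipopGraph hk hkb] at hde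
      rw [dist_lollipopGraph, lollipopDist]
      simp only
      split_ifs <;> omega
  choose DS h_lt h_dist using h_move
  exact ⟨DS, fun h u hu d => h_dist h d u hu, h_lt⟩

theorem fd_lollipopGraph_zero_le (hk : 2 ≤ k) (hkb : k ≤ b) (hb : 0 < b) :
    fd (lollipopGraph b k) ⟨0, hb⟩ ≤ k := by
  obtain ⟨DS, hDS, h_lt⟩ := exists_dValid_lollipopGraph hk hkb
  refine fd_le hDS fun ES _ => ?_
  have h_mem (n : ℕ) : ∀ x ∈ play ES DS ⟨0, hb⟩ n, x.val < k := by
    induction n with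
    | zero => simp [play]; omega
    | succ n ih =>
      simp only [play, List.mem_cons, forall_eq_or_imp]
      exact ⟨h_lt _ _, ih⟩
  calc playScore ES DS ⟨0, hb⟩
      ≤ Set.ncard ((Finset.range k : Finset ℕ) : Set ℕ) :=
        Set.ncard_le_ncard_of_injOn Fin.val
          (fun x ⟨n, hx⟩ => by simpa using h_mem n x hx) Fin.val_injective.injOn
    _ = k := by rw [Set.ncard_coe_finset, Finset.card_range]

/-- An Explorer strategy for the lollipop graph: return to `0` by calling eccentricities, and
at `0` call the distance of an unvisited level if there is one. -/
theorem exists_eValid_lollipopGraph (hk : 2 ≤ k) (hkb : k ≤ b) :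
    ∃ ES : List (Fin b) → ℕ, EValid (lollipopGraph b k) ES ∧
      ∀ (h : List (Fin b)) (u : Fin b), h.head? = some u →
        (u.val ≠ 0 → ES h = max (min u.val (k - 1)) (k - 1 - min u.val (k - 1))) ∧
        (u.val = 0 → (∃ d < k, ∀ x ∈ h, min x.val (k - 1) ≠ d) →
          0 < ES h ∧ ES h < k ∧ ∀ x ∈ h, min x.val (k - 1) ≠ ES h) := by
  have h_call (h : List (Fin b)) : ∃ e : ℕ, ∀ u : Fin b, h.head? = some u →
      (1 ≤ e ∧ e ≤ max (min u.val (k - 1)) (k - 1 - min u.val (k - 1))) ∧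
      (u.val ≠ 0 → e = max (min u.val (k - 1)) (k - 1 - min u.val (k - 1))) ∧
      (u.val = 0 → (∃ d < k, ∀ x ∈ h, min x.val (k - 1) ≠ d) →
          0 < e ∧ e < k ∧ ∀ x ∈ h, min x.val (k - 1) ≠ e) := by
    cases h with
    | nil => exact ⟨0, by simp⟩
    | cons a t =>
      simp only [List.head?_cons, Option.some.injEq, forall_eq']
      by_cases ha : a.val = 0
      · by_cases hd : ∃ d < k, ∀ x ∈ a :: t, min x.val (k - 1) ≠ d
        · obtain ⟨d, hdk, hd⟩ := hd
          have h_ne := hd a (by simp)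
          exact ⟨d, by omega, by omega, fun _ _ => ⟨by omega, hdk, hd⟩⟩
        · exact ⟨1, by omega, by omega, fun _ h => absurd h hd⟩
      · exact ⟨_, by omega, fun _ => rfl, fun h => absurd h ha⟩
  choose ES hES using h_call
  refine ⟨ES, fun h u hu _ => ?_, fun h u hu => (hES h u hu).2⟩
  rw [ecc_lollipopGraph hk hkb]
  exact (hES h u hu).1

theorem le_fd_lollipopGraph (hk : 2 ≤ k) (hkb : k ≤ b) (v : Fin b) :
    k ≤ fd (lollipopGraph b k) v := by
  obtain ⟨DS₀, hDS₀, -⟩ := exists_dValid_lollipopGraph hk hkb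
  obtain ⟨ES, hES, h_call⟩ := exists_eValid_lollipopGraph hk hkb
  refine le_fd hDS₀ hES fun DS hDS => ?_
  have h_move (n : ℕ) (u : Fin b) (hu : (play ES DS v n).head? = some u) :
      ∃ w, play ES DS v (n + 1) = w :: play ES DS v n ∧
        lollipopDist b k u w = ES (play ES DS v n) := by
    refine ⟨_, rfl, ?_⟩
    have h_ecc : 1 ≤ ecc (lollipopGraph b k) u := by
      rw [ecc_lollipopGraph hk hkb]
      omega
    have h_legal := hES _ u hu h_ecc
    rw [← dist_lollipopGraph]
    exact hDS _ u hu _ h_legal.1 h_legal.2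
  rcases hk.eq_or_lt with rfl | hk3
  · obtain ⟨w, hw, h_dist⟩ := h_move 0 v rfl
    have h_ne : v ≠ w := by
      rintro rfl
      have h_pos := (hES _ v (rfl : (play ES DS v 0).head? = some v)
        (by rw [ecc_lollipopGraph hk hkb]; omega)).1
      simp [lollipopDist] at h_dist
      omega
    rw [← Set.ncard_pair h_ne]
    refine Set.ncard_le_ncard ?_
    rintro x (rfl | rfl)
    · exact ⟨0, by simp [play]⟩
    · exact ⟨1, by simp [hw]⟩
  have h_next (n : ℕ) (u : Fin b) (hu : (play ES DS v n).head? = some u) :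
      ∃ w, (play ES DS v (n + 1)).head? = some w ∧
        (u.val ≠ 0 → (w.val = 0 ∨ k - 1 ≤ w.val) ∧ (k - 1 ≤ u.val → w.val = 0)) := by
    obtain ⟨w, hw, h_dist⟩ := h_move n u hu
    refine ⟨w, by simp [hw], fun h0 => ?_⟩
    rw [(h_call _ u hu).1 h0] at h_dist
    unfold lollipopDist at h_dist
    split_ifs at h_dist <;> omega
  have h_zero (n : ℕ) : ∃ m ≥ n, ∃ u : Fin b, (play ES DS v m).head? = some u ∧ u.val = 0 := by
    obtain ⟨u₀, h₀⟩ := exists_head?_play ES DS v n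
    obtain ⟨u₁, h₁, h₁'⟩ := h_next n u₀ h₀
    obtain ⟨u₂, h₂, h₂'⟩ := h_next (n + 1) u₁ h₁
    by_cases hu₀ : u₀.val = 0
    · exact ⟨n, le_rfl, u₀, h₀, hu₀⟩
    by_cases hu₁ : u₁.val = 0
    · exact ⟨n + 1, by omega, u₁, h₁, hu₁⟩
    · exact ⟨n + 2, by omega, u₂, h₂, (h₂' hu₁).2 ((h₁' hu₀).1.resolve_left hu₁)⟩
  let level (x : Fin b) : ℕ := min x.val (k - 1)
  let levels (n : ℕ) : Finset ℕ := (play ES DS v n).toFinset.image level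
  have h_mono {i j : ℕ} (hij : i ≤ j) : levels i ⊆ levels j :=
    Finset.image_subset_image fun x hx => by
      rw [List.mem_toFinset] at hx ⊢
      exact mem_play_of_le hij hx
  have h_card (j : ℕ) (hj : j ≤ k) : ∃ n, j ≤ (levels n).card := by
    induction j with
    | zero => exact ⟨0, Nat.zero_le _⟩
    | succ j ih =>
      obtain ⟨n, hn⟩ := ih (by omega)
      obtain ⟨m, hnm, u, hu, hu0⟩ := h_zero n
      by_cases h_unvisited : ∃ d < k, ∀ x ∈ play ES DS v m, level x ≠ d
      · obtain ⟨h_pos, h_lt, h_new⟩ := (h_call _ u hu).2 hu0 h_unvisited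
        obtain ⟨w, hw, h_dist⟩ := h_move m u hu
        have h_level : level w = ES (play ES DS v m) := by
          simp only [level]
          unfold lollipopDist at h_dist
          split_ifs at h_dist <;> omega
        refine ⟨m + 1, ?_⟩
        have h_insert : levels (m + 1) = insert (level w) (levels m) := by
          simp only [levels, hw, List.toFinset_cons, Finset.image_insert]
        have h_notMem : level w ∉ levels m := by
          simp only [levels, Finset.mem_image, List.mem_toFinset, not_exists, not_and]
          rw [h_level]
          exact h_new
        rw [h_insert, Finset.card_insert_of_notMem h_notMem]
        have := Finset.card_le_card (h_mono hnm)
        omega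
      · push Not at h_unvisited
        refine ⟨m, hj.trans ?_⟩
        calc k = (Finset.range k).card := (Finset.card_range k).symm
          _ ≤ (levels m).card := Finset.card_le_card fun d hd => by
            obtain ⟨x, hx, hxd⟩ := h_unvisited d (Finset.mem_range.mp hd)
            exact Finset.mem_image.mpr ⟨x, List.mem_toFinset.mpr hx, hxd⟩
  obtain ⟨n, hn⟩ := h_card k le_rfl
  calc k ≤ (levels n).card := hn
    _ ≤ (play ES DS v n).toFinset.card := Finset.card_image_le
    _ = Set.ncard ((play ES DS v n).toFinset : Set (Fin b)) := (Set.ncard_coe_finset _).symm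
    _ ≤ playScore ES DS v := Set.ncard_le_ncard fun x hx => ⟨n, by simpa using hx⟩

end Lollipop

/-- For every `b ≥ 2` and `2 ≤ k ≤ b` there is a connected simple graph on
`b` vertices whose minimum over starting vertices of `f_d` equals `k`. -/
theorem stmt_3 (b k : ℕ) (hb : 2 ≤ b) (hk : 2 ≤ k) (hkb : k ≤ b) :
    ∃ G : SimpleGraph (Fin b), G.Connected ∧
      sInf {r : ℕ | ∃ v : Fin b, r = fd G v} = k := by
  have hb0 : 0 < b := by omega
  refine ⟨lollipopGraph b k, connected_lollipopGraph hb0, le_antisymm ?_ ?_⟩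
  · exact le_trans (Nat.sInf_le ⟨⟨0, hb0⟩, rfl⟩) (fd_lollipopGraph_zero_le hk hkb hb0)
  · refine le_csInf ⟨_, ⟨0, hb0⟩, rfl⟩ ?_
    rintro _ ⟨v, rfl⟩
    exact le_fd_lollipopGraph hk hkb v
end

section
/- Let n, m ≥ 2 be integers and let c be an integer with 0 ≤ c ≤ m−1. Then the set A = {(0,j) : 0 ≤ j ≤ m−1} ∪ {(n−1,j) : 0 ≤ j ≤ m−1} ∪ {(i,c) : 0 ≤ i ≤ n−1}, consisting of the two extreme rows together with one full column of the grid graph L_{n,m}, is a closed set of L_{n,m}, and it has cardinality 2m + n − 2. -/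
open SimpleGraph

variable {V : Type*}

/-- The length of a walk in a path graph bounds the difference of the indices of its endpoints. -/
lemma SimpleGraph.Walk.val_sub_val_le_length_pathGraph {n : ℕ} {u v : Fin n}
    (w : (pathGraph n).Walk u v) :
    ((u : ℕ) - v) + (v - u) ≤ w.length := by
  induction w with
  | nil => simp
  | cons h w ih =>
    rw [pathGraph_adj] at h
    rw [Walk.length_cons]
    omega

lemma SimpleGraph.dist_pathGraph_le_of_val_add_eq {n k : ℕ} {u v : Fin n}
    (h : (u : ℕ) + k = v) : (pathGraph n).dist u v ≤ k := by
  induction k generalizing v with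
  | zero => simp [show u = v from Fin.ext (by simpa using h)]
  | succ k ih =>
    have hw : (u : ℕ) + k < n := by omega
    have hadj : (pathGraph n).Adj ⟨u + k, hw⟩ v := by
      rw [pathGraph_adj]; left; simp only; omega
    have := hadj.reachable.dist_triangle_right u
    rw [dist_eq_one_iff_adj.mpr hadj] at this
    exact this.trans (Nat.add_le_add_right (ih rfl) 1)

lemma SimpleGraph.dist_pathGraph {n : ℕ} (u v : Fin n) :
    (pathGraph n).dist u v = ((u : ℕ) - v) + (v - u) := by
  apply le_antisymm
  · rcases le_total (u : ℕ) v with h | h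
    · exact (dist_pathGraph_le_of_val_add_eq (Nat.add_sub_of_le h)).trans (by omega)
    · rw [dist_comm]
      exact (dist_pathGraph_le_of_val_add_eq (Nat.add_sub_of_le h)).trans (by omega)
  · obtain ⟨w, hw⟩ := (pathGraph_preconnected n u v).exists_walk_length_eq_dist
    exact hw ▸ w.val_sub_val_le_length_pathGraph

lemma dist_gridGraph {n m : ℕ} (x y : Fin n × Fin m) :
    (gridGraph n m).dist x y =
      (((x.1 : ℕ) - y.1) + (y.1 - x.1)) + (((x.2 : ℕ) - y.2) + (y.2 - x.2)) := by
  rw [← dist_pathGraph, ← dist_pathGraph, gridGraph, SimpleGraph.dist, edist_boxProd,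
    ENat.toNat_add (edist_ne_top_iff_reachable.mpr (pathGraph_preconnected n _ _))
      (edist_ne_top_iff_reachable.mpr (pathGraph_preconnected m _ _))]
  rfl

/-- Every value up to the distance between two vertices of a path is realised as a distance. -/
lemma Fin.exists_val_sub_add_sub_eq {m k : ℕ} (b q : Fin m)
    (hk : k ≤ ((b : ℕ) - q) + (q - b)) :
    ∃ j : Fin m, ((b : ℕ) - j) + (j - b) = k := by
  rcases le_total (b : ℕ) q with h | h
  · exact ⟨⟨b + k, by omega⟩, by simp only; omega⟩
  · exact ⟨⟨b - k, by omega⟩, by simp only; omega⟩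

lemma isClosedSet_extreme_rows_union_column (n m : ℕ) (hn : 0 < n) (c : Fin m) :
    IsClosedSet (gridGraph n m)
      {p : Fin n × Fin m | (p.1 : ℕ) = 0 ∨ (p.1 : ℕ) = n - 1 ∨ p.2 = c} := by
  refine ⟨⟨(⟨0, hn⟩, c), Or.inl rfl⟩, ?_⟩
  rintro ⟨a, b⟩ hu ⟨p, q⟩
  simp only [dist_gridGraph, Set.mem_ofPred_eq, Prod.exists] at hu ⊢
  generalize hd : (((a : ℕ) - p) + (p - a)) + (((b : ℕ) - q) + (q - b)) = d
  have hp := p.isLt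
  have ha := a.isLt
  rcases hu with h | h | rfl
  · by_cases h1 : n - 1 ≤ d
    · obtain ⟨j, hj⟩ := Fin.exists_val_sub_add_sub_eq (k := d - (n - 1)) b q (by omega)
      exact ⟨⟨n - 1, by omega⟩, j, Or.inr (Or.inl rfl), by simp only; omega⟩
    by_cases h2 : ((b : ℕ) - c) + (c - b) ≤ d
    · exact ⟨⟨d - (((b : ℕ) - c) + (c - b)), by omega⟩, c, Or.inr (Or.inr rfl),
        by simp only; omega⟩
    · obtain ⟨j, hj⟩ := Fin.exists_val_sub_add_sub_eq (k := d) b c (by omega)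
      exact ⟨a, j, Or.inl h, by omega⟩
  · by_cases h1 : n - 1 ≤ d
    · obtain ⟨j, hj⟩ := Fin.exists_val_sub_add_sub_eq (k := d - (n - 1)) b q (by omega)
      exact ⟨⟨0, hn⟩, j, Or.inl rfl, by simp only; omega⟩
    by_cases h2 : ((b : ℕ) - c) + (c - b) ≤ d
    · exact ⟨⟨n - 1 - (d - (((b : ℕ) - c) + (c - b))), by omega⟩, c, Or.inr (Or.inr rfl),
        by simp only; omega⟩
    · obtain ⟨j, hj⟩ := Fin.exists_val_sub_add_sub_eq (k := d) b c (by omega)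
      exact ⟨a, j, Or.inr (Or.inl h), by omega⟩
  · by_cases h1 : d ≤ a
    · exact ⟨⟨a - d, by omega⟩, b, Or.inr (Or.inr rfl), by simp only; omega⟩
    by_cases h2 : d ≤ n - 1 - a
    · exact ⟨⟨a + d, by omega⟩, b, Or.inr (Or.inr rfl), by simp only; omega⟩
    rcases le_total (n - 1 - a) (a : ℕ) with h3 | h3
    · obtain ⟨j, hj⟩ := Fin.exists_val_sub_add_sub_eq (k := d - a) b q (by omega)
      exact ⟨⟨0, hn⟩, j, Or.inl rfl, by simp only; omega⟩
    · obtain ⟨j, hj⟩ := Fin.exists_val_sub_add_sub_eq (k := d - (n - 1 - a)) b q (by omega)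
      exact ⟨⟨n - 1, by omega⟩, j, Or.inr (Or.inl rfl), by simp only; omega⟩

lemma ncard_extreme_rows_union_column (n m : ℕ) (hn : 2 ≤ n) (c : Fin m) :
    Set.ncard {p : Fin n × Fin m | (p.1 : ℕ) = 0 ∨ (p.1 : ℕ) = n - 1 ∨ p.2 = c}
      = 2 * m + n - 2 := by
  let R : Finset (Fin n) := {⟨0, by omega⟩, ⟨n - 1, by omega⟩}
  have hR : R.card = 2 := Finset.card_pair (by rw [ne_eq, Fin.mk.injEq]; omega)
  have hset : {p : Fin n × Fin m | (p.1 : ℕ) = 0 ∨ (p.1 : ℕ) = n - 1 ∨ p.2 = c}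
      = ((R ×ˢ Finset.univ) ∪ (Rᶜ ×ˢ {c}) : Finset (Fin n × Fin m)) := by
    ext ⟨i, j⟩
    simp only [R, Finset.coe_union, Finset.coe_product, Set.mem_ofPred_eq, Set.mem_union,
      Set.mem_prod, Finset.mem_coe, Finset.mem_insert, Finset.mem_singleton, Finset.mem_univ,
      Finset.mem_compl, Fin.ext_iff]
    tauto
  have hdisj : Disjoint (R ×ˢ (Finset.univ : Finset (Fin m))) (Rᶜ ×ˢ {c}) :=
    Finset.disjoint_product.mpr (Or.inl disjoint_compl_right)
  rw [hset, Set.ncard_coe_finset, Finset.card_union_of_disjoint hdisj, Finset.card_product,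
    Finset.card_product, Finset.card_compl, hR, Finset.card_fin,
    Fintype.card_fin, Finset.card_singleton]
  omega

/-- For `n, m ≥ 2` and a column index `c`, the two extreme rows together
with the full column `c` form a closed set of the grid `L_{n,m}` of cardinality
`2m + n - 2`. -/
theorem stmt_6 (n m : ℕ) (hn : 2 ≤ n) (hm : 2 ≤ m) (c : Fin m) :
    IsClosedSet (gridGraph n m)
      {p : Fin n × Fin m | (p.1 : ℕ) = 0 ∨ (p.1 : ℕ) = n - 1 ∨ p.2 = c} ∧
    Set.ncard {p : Fin n × Fin m | (p.1 : ℕ) = 0 ∨ (p.1 : ℕ) = n - 1 ∨ p.2 = c}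
      = 2 * m + n - 2 := by
  exact ⟨isClosedSet_extreme_rows_union_column n m (by omega) c,
    ncard_extreme_rows_union_column n m hn c⟩
end
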